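/- arXiv:2301.05098 — 2 statements merged into one kernel-verified Lean document; each statement's English description precedes it below -/
import Mathlib

section
/- Let n ≥ 3 and let S₂ ⊆ {0,1}^n be the 2-charge constrained words. Define b₀ = 10^{n-1} and, for 1 ≤ i ≤ ⌈n/2⌉-1, bᵢ supported exactly on positions {2i, 2i+1}. For s = Σᵢ aᵢbᵢ (sum over 𝔽₂ⁿ) with a ∈ {0,1}^{⌈n/2⌉}, the Fourier coefficient satisfies 1̂_{S₂}(s) = 2^{⌊n/2⌋-n}·(-1)^{w(a)-a₀}, where w(a) is the Hamming weight of a. -/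
open Finset

noncomputable def chr {n : ℕ} (x s : Fin n → ZMod 2) : ℝ :=
  (-1) ^ (∑ i, (x i * s i).val)

noncomputable def ft {n : ℕ} (f : (Fin n → ZMod 2) → ℝ) (s : Fin n → ZMod 2) : ℝ :=
  (∑ x, f x * chr x s) / 2 ^ n

def inS2 {n : ℕ} (x : Fin n → ZMod 2) : Prop :=
  ∀ r : ℕ, 1 ≤ r → r ≤ n →
    0 ≤ (∑ i : Fin n, if (i : ℕ) < r then (if x i = 0 then (1 : ℤ) else -1) else 0) ∧
    (∑ i : Fin n, if (i : ℕ) < r then (if x i = 0 then (1 : ℤ) else -1) else 0) ≤ 2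

def bvec (n : ℕ) (i : ℕ) : Fin n → ZMod 2 :=
  if i = 0 then (fun j => if (j : ℕ) = 0 then 1 else 0)
  else fun j => if (j : ℕ) = 2 * i - 1 ∨ (j : ℕ) = 2 * i then 1 else 0

noncomputable def psum {n : ℕ} (x : Fin n → ZMod 2) (r : ℕ) : ℤ :=
  ∑ i : Fin n, if (i : ℕ) < r then (if x i = 0 then (1 : ℤ) else -1) else 0

lemma psum_zero {n : ℕ} (x : Fin n → ZMod 2) : psum x 0 = 0 := by
  simp [psum]

lemma psum_succ {n : ℕ} (x : Fin n → ZMod 2) (r : ℕ) (hr : r < n) :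
    psum x (r + 1) = psum x r + (if x ⟨r, hr⟩ = 0 then (1 : ℤ) else -1) := by
  have h : (if x ⟨r, hr⟩ = 0 then (1 : ℤ) else -1) =
      ∑ i : Fin n, if i = ⟨r, hr⟩ then (if x i = 0 then (1 : ℤ) else -1) else 0 := by
    simp
  rw [h, psum, psum, ← Finset.sum_add_distrib]
  refine Finset.sum_congr rfl fun i _ => ?_
  by_cases h1 : (i : ℕ) < r
  · have h2 : i ≠ ⟨r, hr⟩ := by rintro rfl; simp at h1
    have h3 : (i : ℕ) < r + 1 := by omega
    rw [if_pos h1, if_neg h2, if_pos h3, add_zero]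
  · by_cases h2 : i = ⟨r, hr⟩
    · subst h2; simp
    · have h3 : ¬ (i : ℕ) < r + 1 := by
        intro h4
        apply h2
        apply Fin.ext
        simp only
        omega
      rw [if_neg h1, if_neg h2, if_neg h3, add_zero]

lemma zmod2_cases (z : ZMod 2) : z = 0 ∨ z = 1 := by
  revert z; decide

lemma inS2_iff {n : ℕ} (hn : 3 ≤ n) (x : Fin n → ZMod 2) :
    inS2 x ↔ x ⟨0, by omega⟩ = 0 ∧
      ∀ k : ℕ, ∀ h : 2 * k + 2 < n, x ⟨2 * k + 1, by omega⟩ + x ⟨2 * k + 2, h⟩ = 1 := by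
  have h0 := psum_succ x 0 (by omega)
  rw [psum_zero] at h0
  constructor
  · intro H
    have H' : ∀ r, 1 ≤ r → r ≤ n → 0 ≤ psum x r ∧ psum x r ≤ 2 := H
    have hx0 : x ⟨0, by omega⟩ = 0 := by
      by_contra hne
      have := H' 1 le_rfl (by omega)
      simp [hne] at h0
      omega
    rw [if_pos hx0] at h0
    have key : ∀ k : ℕ, ∀ h : 2 * k + 2 < n, psum x (2 * k + 1) = 1 →
        psum x (2 * k + 3) = 1 ∧ x ⟨2 * k + 1, by omega⟩ + x ⟨2 * k + 2, h⟩ = 1 := by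
      intro k h hk
      have e1 : psum x (2 * k + 2) = _ := psum_succ x (2 * k + 1) (by omega)
      have e2 : psum x (2 * k + 3) = _ := psum_succ x (2 * k + 2) h
      have b1 := H' (2 * k + 2) (by omega) (by omega)
      have b2 := H' (2 * k + 3) (by omega) (by omega)
      rcases zmod2_cases (x ⟨2 * k + 1, by omega⟩) with c1 | c1 <;>
      rcases zmod2_cases (x ⟨2 * k + 2, h⟩) with c2 | c2 <;>
      simp [c1, c2] at e1 e2 ⊢ <;> omega
    have all : ∀ k : ℕ, 2 * k < n → psum x (2 * k + 1) = 1 := by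
      intro k
      induction k with
      | zero => intro _; simpa using h0
      | succ k ih => intro h; exact (key k (by omega) (ih (by omega))).1
    exact ⟨hx0, fun k h => (key k h (all k (by omega))).2⟩
  · rintro ⟨hx0, H⟩
    rw [if_pos hx0] at h0
    have all : ∀ k : ℕ, 2 * k < n → psum x (2 * k + 1) = 1 := by
      intro k
      induction k with
      | zero => intro _; simpa using h0
      | succ k ih =>
        intro h
        have hk := ih (by omega)
        have e1 : psum x (2 * k + 2) = _ := psum_succ x (2 * k + 1) (by omega)
        have e2 : psum x (2 * k + 3) = _ := psum_succ x (2 * k + 2) (by omega)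
        have e3 := H k (by omega)
        have e4 : 2 * (k + 1) + 1 = 2 * k + 3 := by ring
        rw [e4]
        rcases zmod2_cases (x ⟨2 * k + 1, by omega⟩) with c1 | c1 <;>
        rcases zmod2_cases (x ⟨2 * k + 2, by omega⟩) with c2 | c2 <;>
        simp [c1, c2] at e1 e2 e3 <;> omega
    show ∀ r, 1 ≤ r → r ≤ n → 0 ≤ psum x r ∧ psum x r ≤ 2
    intro r h1 h2
    rcases Nat.even_or_odd' r with ⟨k, rfl | rfl⟩
    · obtain ⟨m, rfl⟩ : ∃ m, k = m + 1 := ⟨k - 1, by omega⟩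
      have := all m (by omega)
      have e1 := psum_succ x (2 * m + 1) (by omega)
      have e4 : 2 * (m + 1) = 2 * m + 1 + 1 := by ring
      rw [e4, e1, this]
      split_ifs <;> norm_num
    · rw [all k (by omega)]; norm_num

lemma neg_one_pow_cast {m k : ℕ} (h : (m : ZMod 2) = k) : (-1 : ℝ) ^ m = (-1) ^ k := by
  rw [ZMod.natCast_eq_natCast_iff] at h
  rw [neg_one_pow_eq_pow_mod_two, neg_one_pow_eq_pow_mod_two (n := k), h]

lemma sum_bvec {n : ℕ} (hn : 3 ≤ n) (x : Fin n → ZMod 2) (hx : inS2 x)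
    (k : ℕ) (hk : k < (n + 1) / 2) :
    ∑ j, x j * bvec n k j = if k = 0 then 0 else 1 := by
  rw [inS2_iff hn] at hx
  obtain ⟨h0, H⟩ := hx
  by_cases hk0 : k = 0
  · subst hk0
    rw [if_pos rfl]
    refine Finset.sum_eq_zero fun j _ => ?_
    by_cases hj : (j : ℕ) = 0
    · have : j = ⟨0, by omega⟩ := Fin.ext hj
      rw [this, h0, zero_mul]
    · simp [bvec, hj]
  · obtain ⟨m, rfl⟩ : ∃ m, k = m + 1 := ⟨k - 1, by omega⟩
    rw [if_neg hk0, ← H m (by omega)]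
    have hne : (⟨2 * m + 1, by omega⟩ : Fin n) ≠ ⟨2 * m + 2, by omega⟩ := by
      simp
    rw [← Finset.sum_subset (Finset.subset_univ {⟨2 * m + 1, by omega⟩, ⟨2 * m + 2, by omega⟩}),
      Finset.sum_pair hne]
    · have a1 : 2 * m + 1 = 2 * (m + 1) - 1 := by omega
      have a2 : 2 * m + 2 = 2 * (m + 1) := by omega
      simp [bvec, a1, a2]
    · intro j _ hj
      simp only [Finset.mem_insert, Finset.mem_singleton, Fin.ext_iff, not_or] at hj
      have : ¬ ((j : ℕ) = 2 * (m + 1) - 1 ∨ (j : ℕ) = 2 * (m + 1)) := by omega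
      simp only [bvec, if_neg hk0, if_neg this, mul_zero]

lemma chr_eq {n : ℕ} (hn : 3 ≤ n) (a : Fin ((n + 1) / 2) → ZMod 2)
    (x : Fin n → ZMod 2) (hx : inS2 x) (hpos : 0 < (n + 1) / 2) :
    chr x (∑ i : Fin ((n + 1) / 2), a i • bvec n (i : ℕ)) =
      (-1) ^ ((∑ i, (a i).val) - (a ⟨0, hpos⟩).val) := by
  unfold chr
  apply neg_one_pow_cast
  have hle : (a ⟨0, hpos⟩).val ≤ ∑ i, (a i).val :=
    Finset.single_le_sum (f := fun i => (a i).val) (fun _ _ => Nat.zero_le _) (Finset.mem_univ _)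
  rw [Nat.cast_sub hle]
  push_cast
  simp only [ZMod.natCast_val, ZMod.cast_id', id]
  simp only [Finset.sum_apply, Pi.smul_apply, smul_eq_mul, Finset.mul_sum]
  rw [Finset.sum_comm]
  have h1 : ∀ i : Fin ((n + 1) / 2), ∑ j, x j * (a i * bvec n (i : ℕ) j) =
      a i - (if i = ⟨0, hpos⟩ then a i else 0) := by
    intro i
    have := sum_bvec hn x hx i i.2
    have h2 : ∑ j, x j * (a i * bvec n (i : ℕ) j) = a i * ∑ j, x j * bvec n (i : ℕ) j := by
      rw [Finset.mul_sum]
      exact Finset.sum_congr rfl fun j _ => by ring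
    rw [h2, this]
    by_cases hi : i = ⟨0, hpos⟩
    · simp [hi]
    · have : (i : ℕ) ≠ 0 := fun h => hi (Fin.ext h)
      simp [hi, this]
  rw [Finset.sum_congr rfl fun i _ => h1 i, Finset.sum_sub_distrib]
  simp

def s2word {n : ℕ} (y : Fin (n / 2) → ZMod 2) (j : Fin n) : ZMod 2 :=
  if h0 : (j : ℕ) = 0 then 0
  else if h : (j : ℕ) % 2 = 1 then y ⟨(j : ℕ) / 2, by omega⟩
  else y ⟨(j : ℕ) / 2 - 1, by omega⟩ + 1

def s2equiv {n : ℕ} (hn : 3 ≤ n) : {x : Fin n → ZMod 2 // inS2 x} ≃ (Fin (n / 2) → ZMod 2) where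
  toFun x k := x.1 ⟨2 * k + 1, by omega⟩
  invFun y := ⟨s2word y, by
    rw [inS2_iff hn]
    refine ⟨by simp [s2word], fun k h => ?_⟩
    have a1 : (2 * k + 1) / 2 = k := by omega
    have a2 : (2 * k + 2) / 2 - 1 = k := by omega
    have a3 : (2 * k + 1) % 2 = 1 := by omega
    have a4 : ¬ (2 * k + 2) % 2 = 1 := by omega
    simp only [s2word, a1, a2, a3, a4]
    simp [← add_assoc, CharTwo.add_self_eq_zero]⟩
  left_inv := by
    rintro ⟨x, hx⟩
    rw [inS2_iff hn] at hx
    obtain ⟨h0, H⟩ := hx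
    apply Subtype.ext
    funext ⟨j, hj⟩
    simp only [s2word]
    split_ifs with c1 c2
    · subst c1; exact h0.symm
    · congr 2; omega
    · obtain ⟨k, rfl⟩ : ∃ k, j = 2 * k + 2 := ⟨j / 2 - 1, by omega⟩
      have a2 : (2 * k + 2) / 2 - 1 = k := by omega
      simp only [a2]
      rw [← H k hj, ← add_assoc, CharTwo.add_self_eq_zero, zero_add]
  right_inv := by
    intro y
    funext ⟨k, hk⟩
    have a1 : (2 * k + 1) / 2 = k := by omega
    have a3 : (2 * k + 1) % 2 = 1 := by omega
    simp [s2word, a1, a3]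

open scoped Classical in
theorem ft_S2_on_span {n : ℕ} (hn : 3 ≤ n) (a : Fin ((n + 1) / 2) → ZMod 2)
    (s : Fin n → ZMod 2) (hs : s = ∑ i : Fin ((n + 1) / 2), a i • bvec n (i : ℕ)) :
    ft (fun x => if inS2 x then (1 : ℝ) else 0) s =
      2 ^ (n / 2) / 2 ^ n *
        (-1) ^ ((∑ i, (a i).val) - (a ⟨0, by omega⟩).val) := by
  subst hs
  have h1 : ∀ x : Fin n → ZMod 2, (if inS2 x then (1 : ℝ) else 0) *
      chr x (∑ i : Fin ((n + 1) / 2), a i • bvec n (i : ℕ)) =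
      (if inS2 x then (1 : ℝ) else 0) *
        (-1) ^ ((∑ i, (a i).val) - (a ⟨0, by omega⟩).val) := by
    intro x
    by_cases hx : inS2 x
    · rw [chr_eq hn a x hx (by omega)]
    · simp [hx]
  have hc : (∑ x : Fin n → ZMod 2, if inS2 x then (1 : ℝ) else 0) = 2 ^ (n / 2) := by
    rw [Finset.sum_boole, ← Fintype.card_subtype, Fintype.card_congr (s2equiv hn)]
    simp [ZMod.card]
  unfold ft
  rw [Finset.sum_congr rfl fun x _ => h1 x, ← Finset.sum_mul, hc]
  ring
end

section
/- Let S^d ⊆ {0,1}^n be the set of (d,∞)-runlength limited words (any two successive 1s separated by at least d 0s). For n ≥ d+2 and s ∈ {0,1}^n, the Fourier coefficients satisfy the recurrence 1̂_{S^d}^{(n)}(s) = (1/2)·1̂_{S^d}^{(n-1)}(s₂…s_n) + (-1)^{s₁}·2^{-(d+1)}·1̂_{S^d}^{(n-d-1)}(s_{d+2}…s_n). -/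
open Finset

def isRLL (d : ℕ) {n : ℕ} (x : Fin n → ZMod 2) : Prop :=
  ∀ i j : Fin n, i < j → x i = 1 → x j = 1 → d < (j : ℕ) - (i : ℕ)

open scoped Classical in
noncomputable def ftRLL (d n : ℕ) (s : Fin n → ZMod 2) : ℝ :=
  (∑ x : Fin n → ZMod 2,
      (if isRLL d x then (1 : ℝ) else 0) * (-1) ^ (∑ i, (x i * s i).val)) / 2 ^ n

lemma rll_cons_zero (d k : ℕ) (y : Fin k → ZMod 2) :
    isRLL d (Fin.cons 0 y : Fin (k+1) → ZMod 2) ↔ isRLL d y := by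
  unfold isRLL
  constructor
  · intro h i j hij hi hj
    have := h i.succ j.succ (by simpa using hij) (by simpa using hi) (by simpa using hj)
    simpa using this
  · intro h i j
    refine Fin.cases ?_ (fun i => ?_) i
    · intro _ h0; simp at h0
    · refine Fin.cases ?_ (fun j => ?_) j
      · intro _ _ h0; simp at h0
      · intro hij hi hj
        have := h i j (by simpa using hij) (by simpa using hi) (by simpa using hj)
        simpa using this

lemma zmod2_ne_one (a : ZMod 2) (h : a ≠ 1) : a = 0 := by
  revert a; decide

lemma rll_cons_one (d m : ℕ) (u : Fin d → ZMod 2) (z : Fin m → ZMod 2) :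
    isRLL d (Fin.cons 1 (Fin.append u z) : Fin (d+m+1) → ZMod 2) ↔ u = 0 ∧ isRLL d z := by
  unfold isRLL
  constructor
  · intro h
    constructor
    · funext i
      refine zmod2_ne_one _ fun hi => ?_
      have := h 0 (Fin.castAdd m i).succ (Fin.succ_pos _) (by simp) (by simpa using hi)
      have h2 := i.2
      simp at this
      omega
    · intro i j hij hi hj
      have := h (Fin.natAdd d i).succ (Fin.natAdd d j).succ (by simpa using hij)
        (by simpa using hi) (by simpa using hj)
      simp at this
      omega
  · rintro ⟨rfl, h⟩ i j
    refine Fin.cases ?_ (fun j => ?_) j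
    · intro h0; simp at h0
    refine Fin.addCases (fun j => ?_) (fun j => ?_) j
    · intro _ _ h0; simp at h0
    refine Fin.cases ?_ (fun i => ?_) i
    · intro _ _ _
      simp
    refine Fin.addCases (fun i => ?_) (fun i => ?_) i
    · intro _ h0; simp at h0
    intro hij hi hj
    have := h i j (by simpa using hij) (by simpa using hi) (by simpa using hj)
    simp
    omega

lemma ftRLL_core (d m : ℕ) (s : Fin (d+m+1) → ZMod 2) :
    ftRLL d (d+m+1) s = (1/2) * ftRLL d (d+m) (fun i => s i.succ) +
      (-1) ^ (s 0).val * ((2 : ℝ) ^ (d + 1))⁻¹ *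
        ftRLL d m (fun i => s (Fin.natAdd d i).succ) := by
  classical
  unfold ftRLL
  rw [← (Fin.consEquiv (fun _ : Fin (d+m+1) => ZMod 2)).sum_comp, Fintype.sum_prod_type]
  have h2 : ∀ f : ZMod 2 → ℝ, ∑ a, f a = f 0 + f 1 := fun f => Fin.sum_univ_two f
  rw [h2, ← (Fin.appendEquiv d m).sum_comp (fun y : Fin (d+m) → ZMod 2 =>
    (if isRLL d ((Fin.consEquiv (fun _ : Fin (d+m+1) => ZMod 2)) (1, y)) then (1 : ℝ) else 0) *
    (-1) ^ (∑ i, ((Fin.consEquiv (fun _ : Fin (d+m+1) => ZMod 2)) (1, y) i * s i).val)),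
    Fintype.sum_prod_type]
  have e0 : ∀ y, isRLL d ((Fin.consEquiv (fun _ : Fin (d+m+1) => ZMod 2)) (0, y)) ↔ isRLL d y :=
    fun y => rll_cons_zero d _ y
  have e1 : ∀ u z, isRLL d ((Fin.consEquiv (fun _ : Fin (d+m+1) => ZMod 2))
      (1, Fin.append u z)) ↔ u = 0 ∧ isRLL d z :=
    fun u z => rll_cons_one d m u z
  simp only [Fin.appendEquiv, Equiv.coe_fn_mk, e0, e1]
  simp only [Fin.consEquiv_apply]
  rw [Finset.sum_eq_single (0 : Fin d → ZMod 2)]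
  · simp only [Fin.sum_univ_succ, Fin.cons_zero, Fin.cons_succ, Fin.sum_univ_add,
      Fin.append_left, Fin.append_right, Pi.zero_apply, zero_mul, ZMod.val_zero, one_mul,
      Finset.sum_const_zero, zero_add, true_and, pow_add]
    simp only [mul_left_comm _ ((-1 : ℝ) ^ (s 0).val), ← Finset.mul_sum]
    field_simp
  · intro u _ hu
    simp [hu]
  · simp

theorem ftRLL_recurrence {d n : ℕ} (hd : 1 ≤ d) (hn : d + 2 ≤ n)
    (s : Fin n → ZMod 2) :
    ftRLL d n s =
      (1 / 2) * ftRLL d (n - 1) (fun i => s ⟨(i : ℕ) + 1, by omega⟩) +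
        (-1) ^ (s ⟨0, by omega⟩).val * ((2 : ℝ) ^ (d + 1))⁻¹ *
          ftRLL d (n - d - 1) (fun i => s ⟨(i : ℕ) + d + 1, by omega⟩) := by
  have key : ∀ (m : ℕ) (hm : n = d + m + 1) (t : Fin m → ZMod 2)
      (_ : ∀ i : Fin m, t i = s ⟨(i : ℕ) + d + 1, by omega⟩),
      ftRLL d n s =
      (1 / 2) * ftRLL d (n - 1) (fun i => s ⟨(i : ℕ) + 1, by omega⟩) +
        (-1) ^ (s ⟨0, by omega⟩).val * ((2 : ℝ) ^ (d + 1))⁻¹ * ftRLL d m t := by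
    intro m hm t ht
    subst hm
    have ht' : t = fun i => s (Fin.natAdd d i).succ := by
      funext i
      rw [ht]
      congr 1
      ext
      simp
      omega
    rw [ht']
    exact ftRLL_core d m s
  exact key (n - d - 1) (by omega) _ (fun i => rfl)
end
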